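/- arXiv:math/0007046 — 3 statements merged into one kernel-verified Lean document; each statement's English description precedes it below -/
import Mathlib

section
/- Rogers' nonterminating ₆φ₅ summation: Let q, a, b, c, d ∈ ℂ with 0 < |q| < 1, a, b, c, d ≠ 0, a ≠ 1, and |aq/(bcd)| < 1. Assume aq/b, aq/c, aq/d are not of the form q^{-j} for any j ≥ 0 (so all denominators below are nonzero). Then ∑_{k=0}^{∞} ( (1 - a q^{2k}) / (1 - a) ) · ( (a;q)_k (b;q)_k (c;q)_k (d;q)_k / ( (q;q)_k (aq/b;q)_k (aq/c;q)_k (aq/d;q)_k ) ) · (aq/(bcd))^k = (aq, aq/(bc), aq/(bd), aq/(cd); q)_∞ / (aq/b, aq/c, aq/d, aq/(bcd); q)_∞. -/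
/-- The infinite q-Pochhammer symbol `(a; q)_∞ = ∏_{j=0}^∞ (1 - a q^j)`. -/
noncomputable def qPochInf (q a : ℂ) : ℂ := ∏' j : ℕ, (1 - a * q ^ j)

/-- The q-Pochhammer symbol with nonnegative index, `(a; q)_k = ∏_{j=0}^{k-1} (1 - a q^j)`. -/
noncomputable def qPochNat (q a : ℂ) (k : ℕ) : ℂ := ∏ j ∈ Finset.range k, (1 - a * q ^ j)


namespace RogersAux

lemma poly_id (q a b c d Q : ℂ) (hb : b ≠ 0) (hc : c ≠ 0) (hd : d ≠ 0) :
    (1 - a * q / (b * c * d)) * (1 - a * Q ^ 2) *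
        ((1 - a * q / b * Q) * (1 - a * q / c * Q) * (1 - a * q / d * Q)) -
      (1 - a * q * Q ^ 2) * (1 - a * Q) * Q *
        ((1 - a * q / (b * c)) * (1 - a * q / (b * d)) * (1 - a * q / (c * d))) =
      -((1 - a * Q) * (1 - b * Q) * (1 - c * Q) * (1 - d * Q) * (a * q / (b * c * d)) *
        (1 - a * (a * q / (b * c * d)) * (q * Q))) +
      (1 - Q) * (1 - a * (a * q / (b * c * d)) * Q) *
        ((1 - a * q / b * Q) * (1 - a * q / c * Q) * (1 - a * q / d * Q)) := by
  field_simp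
  ring

lemma poly_id1 (q a b c d : ℂ) (hb : b ≠ 0) (hc : c ≠ 0) (hd : d ≠ 0) :
    (1 - a * q / (b * c * d)) * ((1 - a * q / b) * (1 - a * q / c) * (1 - a * q / d)) -
      (1 - a * q) *
        ((1 - a * q / (b * c)) * (1 - a * q / (b * d)) * (1 - a * q / (c * d))) =
      -((1 - b) * (1 - c) * (1 - d) * (a * q / (b * c * d)) *
        (1 - a * (a * q / (b * c * d)) * q)) := by
  field_simp
  ring

lemma P_zero (q x : ℂ) : qPochNat q x 0 = 1 := by simp [qPochNat]

lemma P_one (q x : ℂ) : qPochNat q x 1 = 1 - x := by simp [qPochNat]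

lemma P_succ (q x : ℂ) (k : ℕ) :
    qPochNat q x (k + 1) = qPochNat q x k * (1 - x * q ^ k) := by
  simp [qPochNat, Finset.prod_range_succ]

lemma P_succ' (q x : ℂ) (k : ℕ) :
    qPochNat q x (k + 1) = (1 - x) * qPochNat q (x * q) k := by
  simp only [qPochNat, Finset.prod_range_succ']
  rw [mul_comm]
  simp [pow_succ', mul_assoc]

lemma P_add (q x : ℂ) (n k : ℕ) :
    qPochNat q x (n + k) = qPochNat q x n * qPochNat q (x * q ^ n) k := by
  simp only [qPochNat, Finset.prod_range_add]
  simp [pow_add, mul_assoc]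

lemma P_ne (q x : ℂ) (h : ∀ j : ℕ, 1 - x * q ^ j ≠ 0) (k : ℕ) : qPochNat q x k ≠ 0 :=
  Finset.prod_ne_zero_iff.2 fun j _ => h j

lemma summ (q x : ℂ) (hq1 : ‖q‖ < 1) : Summable fun j : ℕ => ‖-(x * q ^ j)‖ := by
  simp only [norm_neg, norm_mul, norm_pow]
  exact (summable_geometric_of_lt_one (norm_nonneg _) hq1).mul_left _

lemma P_tendsto (q x : ℂ) (hq1 : ‖q‖ < 1) :
    Filter.Tendsto (qPochNat q x) Filter.atTop (nhds (qPochInf q x)) := by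
  have h := (multipliable_one_add_of_summable (summ q x hq1)).hasProd.tendsto_prod_nat
  have e : qPochNat q x = fun n => ∏ j ∈ Finset.range n, (1 - x * q ^ j) := rfl
  rw [e]
  simpa [qPochInf, ← sub_eq_add_neg] using h

lemma PInf_ne (q x : ℂ) (hq1 : ‖q‖ < 1) (h : ∀ j : ℕ, 1 - x * q ^ j ≠ 0) :
    qPochInf q x ≠ 0 := by
  have := tprod_one_add_ne_zero_of_summable (f := fun j : ℕ => -(x * q ^ j))
    (fun j => by simpa [← sub_eq_add_neg] using h j) (summ q x hq1)
  simpa [qPochInf, ← sub_eq_add_neg] using this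

lemma P_bdd (q x : ℂ) (hq1 : ‖q‖ < 1) : ∃ C : ℝ, 0 < C ∧ ∀ k, ‖qPochNat q x k‖ ≤ C := by
  obtain ⟨C, hC⟩ := (Metric.isBounded_range_of_tendsto _ (P_tendsto q x hq1)).exists_norm_le
  exact ⟨max C 1, by positivity, fun k => (hC _ ⟨k, rfl⟩).trans (le_max_left _ _)⟩

lemma Pinv_bdd (q x : ℂ) (hq1 : ‖q‖ < 1) (h : ∀ j : ℕ, 1 - x * q ^ j ≠ 0) :
    ∃ C : ℝ, 0 < C ∧ ∀ k, ‖(qPochNat q x k)⁻¹‖ ≤ C := by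
  obtain ⟨C, hC⟩ := (Metric.isBounded_range_of_tendsto _
    ((P_tendsto q x hq1).inv₀ (PInf_ne q x hq1 h))).exists_norm_le
  exact ⟨max C 1, by positivity, fun k => (hC _ ⟨k, rfl⟩).trans (le_max_left _ _)⟩

/-- uniform bound for shifted inverse -/
lemma Pinv_shift_bdd (q x : ℂ) (hq1 : ‖q‖ < 1) (h : ∀ j : ℕ, 1 - x * q ^ j ≠ 0) :
    ∃ C : ℝ, 0 < C ∧ ∀ n k, ‖(qPochNat q (x * q ^ n) k)⁻¹‖ ≤ C := by
  obtain ⟨C, hC, h1⟩ := Pinv_bdd q x hq1 h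
  obtain ⟨D, hD, h2⟩ := P_bdd q x hq1
  refine ⟨D * C, by positivity, fun n k => ?_⟩
  have : (qPochNat q (x * q ^ n) k)⁻¹ = qPochNat q x n * (qPochNat q x (n + k))⁻¹ := by
    rw [P_add]
    have := P_ne q x h n
    rw [mul_inv, ← mul_assoc, mul_inv_cancel₀ this, one_mul]
  rw [this, norm_mul]
  exact mul_le_mul (h2 _) (h1 _) (norm_nonneg _) hD.le

/-- uniform bound for shifted Pochhammer; the trivial product bound -/
lemma P_shift_bdd (q x : ℂ) (hq1 : ‖q‖ < 1) :
    ∃ C : ℝ, 0 < C ∧ ∀ n k, ‖qPochNat q (x * q ^ n) k‖ ≤ C := by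
  have hs := summ q x hq1
  refine ⟨Real.exp (∑' j : ℕ, ‖-(x * q ^ j)‖), Real.exp_pos _, fun n k => ?_⟩
  have h1 : ‖qPochNat q (x * q ^ n) k‖ ≤ ∏ j ∈ Finset.range k, Real.exp ‖-(x * q ^ j)‖ := by
    rw [qPochNat, norm_prod]
    refine Finset.prod_le_prod (fun _ _ => norm_nonneg _) fun j _ => ?_
    have h2 : ‖x * q ^ n * q ^ j‖ ≤ ‖-(x * q ^ j)‖ := by
      simp only [norm_neg, norm_mul, norm_pow]
      have : ‖q‖ ^ n ≤ 1 := pow_le_one₀ (norm_nonneg _) hq1.le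
      have h3 : 0 ≤ ‖x‖ * ‖q‖ ^ j := by positivity
      nlinarith
    calc ‖1 - x * q ^ n * q ^ j‖ ≤ ‖(1 : ℂ)‖ + ‖x * q ^ n * q ^ j‖ := norm_sub_le _ _
      _ ≤ ‖-(x * q ^ j)‖ + 1 := by rw [norm_one]; linarith
      _ ≤ _ := Real.add_one_le_exp _
  rw [← Real.exp_sum] at h1
  exact h1.trans (Real.exp_le_exp.2 (hs.sum_le_tsum _ fun _ _ => norm_nonneg _))

/-- The common part of the terms of index `k+1`. -/
noncomputable def H (q a b c d : ℂ) (k : ℕ) : ℂ :=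
  qPochNat q (a * q) k * qPochNat q b (k + 1) * qPochNat q c (k + 1) * qPochNat q d (k + 1) *
    (qPochNat q q (k + 1))⁻¹ * (qPochNat q (a * q / b) (k + 1))⁻¹ *
    (qPochNat q (a * q / c) (k + 1))⁻¹ * (qPochNat q (a * q / d) (k + 1))⁻¹ *
    (a * q / (b * c * d)) ^ (k + 1)

/-- The terms of the series. -/
noncomputable def T (q a b c d : ℂ) : ℕ → ℂ
  | 0 => 1
  | k + 1 => (1 - a * q ^ (2 * (k + 1))) * H q a b c d k

/-- The quotient of consecutive values. -/
noncomputable def rho (q a b c d : ℂ) : ℂ :=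
  (1 - a * q) * (1 - a * q / (b * c)) * (1 - a * q / (b * d)) * (1 - a * q / (c * d)) /
    ((1 - a * q / b) * (1 - a * q / c) * (1 - a * q / d) * (1 - a * q / (b * c * d)))

/-- nonvanishing of all relevant factors -/
def NZ (q x : ℂ) : Prop := ∀ j : ℕ, 1 - x * q ^ j ≠ 0

lemma NZ.shift {q x : ℂ} (h : NZ q x) (n : ℕ) : NZ q (x * q ^ n) := fun j => by
  rw [mul_assoc, ← pow_add]; exact h _

lemma NZ.one {q x : ℂ} (h : NZ q x) : 1 - x ≠ 0 := by simpa using h 0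

lemma NZ_of_lt {q x : ℂ} (hq1 : ‖q‖ < 1) (hx : ‖x‖ < 1) : NZ q x := fun j h => by
  have h1 : x * q ^ j = 1 := (sub_eq_zero.1 h).symm
  have h2 : ‖x‖ * ‖q‖ ^ j = 1 := by rw [← norm_pow, ← norm_mul, h1, norm_one]
  have : ‖q‖ ^ j ≤ 1 := pow_le_one₀ (norm_nonneg _) hq1.le
  nlinarith [norm_nonneg x, norm_nonneg q, pow_nonneg (norm_nonneg q) j]

lemma H_bound (q a b c d : ℂ) (hq1 : ‖q‖ < 1)
    (hb : NZ q (a * q / b)) (hc : NZ q (a * q / c)) (hd : NZ q (a * q / d)) :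
    ∃ C : ℝ, 0 < C ∧ ∀ n k, ‖H q (a * q ^ n) b c d k‖ ≤
      C * ‖a * q / (b * c * d) * q ^ n‖ ^ (k + 1) := by
  obtain ⟨C1, p1, h1⟩ := P_shift_bdd q (a * q) hq1
  obtain ⟨C2, p2, h2⟩ := P_bdd q b hq1
  obtain ⟨C3, p3, h3⟩ := P_bdd q c hq1
  obtain ⟨C4, p4, h4⟩ := P_bdd q d hq1
  obtain ⟨C5, p5, h5⟩ := Pinv_bdd q q hq1 (NZ_of_lt hq1 hq1)
  obtain ⟨C6, p6, h6⟩ := Pinv_shift_bdd q _ hq1 hb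
  obtain ⟨C7, p7, h7⟩ := Pinv_shift_bdd q _ hq1 hc
  obtain ⟨C8, p8, h8⟩ := Pinv_shift_bdd q _ hq1 hd
  refine ⟨C1 * C2 * C3 * C4 * C5 * C6 * C7 * C8, by positivity, fun n k => ?_⟩
  have e1 : a * q ^ n * q = a * q * q ^ n := by ring
  have e (x : ℂ) : a * q * q ^ n / x = a * q / x * q ^ n := by ring
  rw [H, e1, e, e, e, e]
  simp only [norm_mul _ ((_ : ℂ) ^ (k + 1)), norm_pow _ (k + 1)]
  refine mul_le_mul_of_nonneg_right ?_ (by positivity)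
  simp only [norm_mul]
  gcongr
  · exact h1 _ _
  · exact h2 _
  · exact h3 _
  · exact h4 _
  · exact h5 _
  · exact h6 _ _
  · exact h7 _ _
  · exact h8 _ _

lemma T_bound (q a b c d : ℂ) (hq1 : ‖q‖ < 1)
    (hb : NZ q (a * q / b)) (hc : NZ q (a * q / c)) (hd : NZ q (a * q / d)) :
    ∃ C : ℝ, 0 < C ∧ ∀ n k, ‖T q (a * q ^ n) b c d k‖ ≤
      C * ‖a * q / (b * c * d) * q ^ n‖ ^ k := by
  obtain ⟨C, p, h⟩ := H_bound q a b c d hq1 hb hc hd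
  refine ⟨(1 + ‖a‖) * C + 1, by positivity, fun n k => ?_⟩
  cases k with
  | zero => simp [T]; positivity
  | succ k =>
    rw [T, norm_mul]
    have h1 : ‖1 - a * q ^ n * q ^ (2 * (k + 1))‖ ≤ 1 + ‖a‖ := by
      refine (norm_sub_le _ _).trans ?_
      rw [norm_one, mul_assoc, ← pow_add, norm_mul, norm_pow]
      have : ‖q‖ ^ (n + 2 * (k + 1)) ≤ 1 := pow_le_one₀ (norm_nonneg _) hq1.le
      nlinarith [norm_nonneg a]
    have h2 := h n k
    have h3 : 0 ≤ ‖a * q / (b * c * d) * q ^ n‖ ^ (k + 1) := by positivity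
    calc _ ≤ (1 + ‖a‖) * (C * ‖a * q / (b * c * d) * q ^ n‖ ^ (k + 1)) := by gcongr
      _ ≤ _ := by nlinarith

lemma T_summable (q a b c d : ℂ) (hq1 : ‖q‖ < 1)
    (hb : NZ q (a * q / b)) (hc : NZ q (a * q / c)) (hd : NZ q (a * q / d))
    (hz : ‖a * q / (b * c * d)‖ < 1) : Summable (T q a b c d) := by
  obtain ⟨C, p, h⟩ := T_bound q a b c d hq1 hb hc hd
  refine Summable.of_norm_bounded
    ((summable_geometric_of_lt_one (norm_nonneg _) hz).mul_left C) fun k => ?_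
  simpa using h 0 k

/-- The certificate. -/
noncomputable def G (q a b c d : ℂ) (k : ℕ) : ℂ :=
  -(1 - a * (a * q / (b * c * d)) * q ^ (k + 1)) / (1 - a * q / (b * c * d)) *
    ((1 - q ^ (k + 1)) * H q a b c d k)

lemma H_succ (q a b c d : ℂ) (k : ℕ) :
    H q a b c d (k + 1) = H q a b c d k *
      ((1 - a * q ^ (k + 1)) * (1 - b * q ^ (k + 1)) * (1 - c * q ^ (k + 1)) *
        (1 - d * q ^ (k + 1)) * (a * q / (b * c * d)) *
        ((1 - q ^ (k + 2))⁻¹ * (1 - a * q / b * q ^ (k + 1))⁻¹ *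
        (1 - a * q / c * q ^ (k + 1))⁻¹ * (1 - a * q / d * q ^ (k + 1))⁻¹)) := by
  have e1 : a * q * q ^ k = a * q ^ (k + 1) := by ring
  have e2 : q * q ^ (k + 1) = q ^ (k + 2) := by ring
  simp only [H]
  rw [P_succ q (a * q) k, P_succ q b (k + 1), P_succ q c (k + 1), P_succ q d (k + 1),
    P_succ q q (k + 1), P_succ q (a * q / b) (k + 1), P_succ q (a * q / c) (k + 1),
    P_succ q (a * q / d) (k + 1), e1, e2, pow_succ _ (k + 1)]
  simp only [mul_inv]
  generalize (1 - q ^ (k + 2))⁻¹ = i1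
  generalize (1 - a * q / b * q ^ (k + 1))⁻¹ = i2
  generalize (1 - a * q / c * q ^ (k + 1))⁻¹ = i3
  generalize (1 - a * q / d * q ^ (k + 1))⁻¹ = i4
  generalize (qPochNat q (a * q / b) (k + 1))⁻¹ = j2
  generalize (qPochNat q (a * q / c) (k + 1))⁻¹ = j3
  generalize (qPochNat q (a * q / d) (k + 1))⁻¹ = j4
  generalize (qPochNat q q (k + 1))⁻¹ = j1
  generalize 1 - a * q ^ (k + 1) = x1
  generalize 1 - b * q ^ (k + 1) = x2
  generalize 1 - c * q ^ (k + 1) = x3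
  generalize 1 - d * q ^ (k + 1) = x4
  generalize a * q / (b * c * d) = z
  ring

lemma inv_shift {q x : ℂ} (h : NZ q x) (k : ℕ) :
    (qPochNat q (x * q) k)⁻¹ = (1 - x) * ((qPochNat q x k)⁻¹ * (1 - x * q ^ k)⁻¹) := by
  rw [← mul_inv, ← P_succ, P_succ', mul_inv, ← mul_assoc, mul_inv_cancel₀ h.one, one_mul]

lemma H_shift (q a b c d : ℂ)
    (hb : NZ q (a * q / b)) (hc : NZ q (a * q / c)) (hd : NZ q (a * q / d)) (k : ℕ) :
    (1 - a * q) * H q (a * q) b c d k = H q a b c d k *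
      ((1 - a * q ^ (k + 1)) * q ^ (k + 1) *
        ((1 - a * q / b) * (1 - a * q / c) * (1 - a * q / d)) *
        ((1 - a * q / b * q ^ (k + 1))⁻¹ *
        (1 - a * q / c * q ^ (k + 1))⁻¹ * (1 - a * q / d * q ^ (k + 1))⁻¹)) := by
  have e1 : a * q * q ^ k = a * q ^ (k + 1) := by ring
  have e (x : ℂ) : a * q * q / x = a * q / x * q := by ring
  have h1 : (1 - a * q) * qPochNat q (a * q * q) k =
      qPochNat q (a * q) k * (1 - a * q ^ (k + 1)) := by
    rw [← P_succ', P_succ, e1]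
  simp only [H]
  rw [e, e, e, e, inv_shift hb, inv_shift hc, inv_shift hd, mul_pow]
  linear_combination (qPochNat q b (k + 1) * qPochNat q c (k + 1) * qPochNat q d (k + 1) *
    (qPochNat q q (k + 1))⁻¹ *
    ((1 - a * q / b) * ((qPochNat q (a * q / b) (k + 1))⁻¹ * (1 - a * q / b * q ^ (k + 1))⁻¹)) *
    ((1 - a * q / c) * ((qPochNat q (a * q / c) (k + 1))⁻¹ * (1 - a * q / c * q ^ (k + 1))⁻¹)) *
    ((1 - a * q / d) * ((qPochNat q (a * q / d) (k + 1))⁻¹ * (1 - a * q / d * q ^ (k + 1))⁻¹)) *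
    ((a * q / (b * c * d)) ^ (k + 1) * q ^ (k + 1))) * h1

lemma step (q a b c d : ℂ) (hq1 : ‖q‖ < 1) (hb0 : b ≠ 0) (hc0 : c ≠ 0) (hd0 : d ≠ 0)
    (hb : NZ q (a * q / b)) (hc : NZ q (a * q / c)) (hd : NZ q (a * q / d))
    (hz : NZ q (a * q / (b * c * d))) (k : ℕ) :
    T q a b c d (k + 1) - rho q a b c d * T q (a * q) b c d (k + 1) =
      G q a b c d (k + 1) - G q a b c d k := by
  have hid := poly_id q a b c d (q ^ (k + 1)) hb0 hc0 hd0
  have hq : 1 - q ^ (k + 2) ≠ 0 := by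
    have := NZ_of_lt hq1 hq1 (k + 1)
    rwa [← pow_succ'] at this
  have hs := H_shift q a b c d hb hc hd k
  have e1 : rho q a b c d * T q (a * q) b c d (k + 1) =
      (1 - a * q / (b * c)) * (1 - a * q / (b * d)) * (1 - a * q / (c * d)) /
      ((1 - a * q / b) * (1 - a * q / c) * (1 - a * q / d) * (1 - a * q / (b * c * d))) *
      (1 - a * q * q ^ (2 * (k + 1))) * ((1 - a * q) * H q (a * q) b c d k) := by
    rw [rho, T]; ring
  rw [e1, hs, G, G, H_succ, T]
  have e2 : q ^ (2 * (k + 1)) = (q ^ (k + 1)) ^ 2 := by ring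
  have e3 : q ^ (k + 1 + 1) = q * q ^ (k + 1) := by ring
  have e4 : q ^ (k + 2) = q * q ^ (k + 1) := by ring
  rw [e4] at hq
  rw [e2, e3]
  have b1 := hb (k + 1)
  have c1 := hc (k + 1)
  have d1 := hd (k + 1)
  have b2 := hb.one
  have c2 := hc.one
  have d2 := hd.one
  have z2 := hz.one
  generalize H q a b c d k = h at *
  generalize q ^ (k + 1) = Q at *
  generalize a * q / b = B at *
  generalize a * q / c = C at *
  generalize a * q / d = D at *
  generalize a * q / (b * c * d) = z at *
  generalize a * q / (b * c) = u at *
  generalize a * q / (b * d) = v at *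
  generalize a * q / (c * d) = w at *
  clear hs e1 hb hc hd hz e2 e3 e4
  generalize 1 - q * Q = q1 at *
  generalize 1 - B * Q = B1 at *
  generalize 1 - C * Q = C1 at *
  generalize 1 - D * Q = D1 at *
  generalize 1 - B = B2 at *
  generalize 1 - C = C2 at *
  generalize 1 - D = D2 at *
  generalize 1 - z = Z at *
  field_simp
  linear_combination h * hid

lemma step0 (q a b c d : ℂ) (hq1 : ‖q‖ < 1) (hb0 : b ≠ 0) (hc0 : c ≠ 0) (hd0 : d ≠ 0)
    (hb : NZ q (a * q / b)) (hc : NZ q (a * q / c)) (hd : NZ q (a * q / d))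
    (hz : NZ q (a * q / (b * c * d))) :
    1 - rho q a b c d = G q a b c d 0 := by
  have hid := poly_id1 q a b c d hb0 hc0 hd0
  have hq : 1 - q ≠ 0 := (NZ_of_lt hq1 hq1).one
  simp only [rho, G, H, P_one, P_zero, zero_add, one_mul, pow_one]
  have b2 := hb.one
  have c2 := hc.one
  have d2 := hd.one
  have z2 := hz.one
  generalize a * q / b = B at *
  generalize a * q / c = C at *
  generalize a * q / d = D at *
  generalize a * q / (b * c * d) = z at *
  generalize a * q / (b * c) = u at *
  generalize a * q / (b * d) = v at *
  generalize a * q / (c * d) = w at *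
  field_simp
  linear_combination hid

lemma sum_eq (q a b c d : ℂ) (hq1 : ‖q‖ < 1) (hb0 : b ≠ 0) (hc0 : c ≠ 0) (hd0 : d ≠ 0)
    (hb : NZ q (a * q / b)) (hc : NZ q (a * q / c)) (hd : NZ q (a * q / d))
    (hz : NZ q (a * q / (b * c * d))) (n : ℕ) :
    ∑ k ∈ Finset.range (n + 1), (T q a b c d k - rho q a b c d * T q (a * q) b c d k) =
      G q a b c d n := by
  induction n with
  | zero => simpa [T] using step0 q a b c d hq1 hb0 hc0 hd0 hb hc hd hz
  | succ n ih =>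
    rw [Finset.sum_range_succ, ih, step q a b c d hq1 hb0 hc0 hd0 hb hc hd hz]
    ring

lemma q_pow_tendsto (q : ℂ) (hq1 : ‖q‖ < 1) :
    Filter.Tendsto (fun n : ℕ => q ^ n) Filter.atTop (nhds 0) :=
  tendsto_pow_atTop_nhds_zero_of_norm_lt_one hq1

lemma G_tendsto (q a b c d : ℂ) (hq1 : ‖q‖ < 1)
    (hb : NZ q (a * q / b)) (hc : NZ q (a * q / c)) (hd : NZ q (a * q / d))
    (hz : ‖a * q / (b * c * d)‖ < 1) :
    Filter.Tendsto (G q a b c d) Filter.atTop (nhds 0) := by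
  obtain ⟨C, p, h⟩ := H_bound q a b c d hq1 hb hc hd
  have hH : Filter.Tendsto (H q a b c d) Filter.atTop (nhds 0) := by
    refine squeeze_zero_norm (a := fun k => C * ‖a * q / (b * c * d)‖ ^ (k + 1))
      (fun k => by simpa using h 0 k) ?_
    have := (tendsto_pow_atTop_nhds_zero_of_lt_one (norm_nonneg _) hz).comp
      (Filter.tendsto_add_atTop_nat 1)
    simpa using this.const_mul C
  have hq := (q_pow_tendsto q hq1).comp (Filter.tendsto_add_atTop_nat 1)
  have h1 : Filter.Tendsto (fun k : ℕ => -(1 - a * (a * q / (b * c * d)) * q ^ (k + 1)) /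
      (1 - a * q / (b * c * d))) Filter.atTop
      (nhds (-(1 - a * (a * q / (b * c * d)) * 0) / (1 - a * q / (b * c * d)))) :=
    ((hq.const_mul (a * (a * q / (b * c * d)))).const_sub 1).neg.div_const _
  have h2 : Filter.Tendsto (fun k : ℕ => 1 - q ^ (k + 1)) Filter.atTop (nhds (1 - 0)) :=
    hq.const_sub 1
  have h3 := h1.mul (h2.mul hH)
  rw [mul_zero (1 - 0 : ℂ), mul_zero (_ / _ : ℂ)] at h3
  exact h3

lemma NZ.shift1 {q a b : ℂ} (h : NZ q (a * q / b)) (n : ℕ) : NZ q (a * q ^ n * q / b) := by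
  have : a * q ^ n * q / b = a * q / b * q ^ n := by ring
  rw [this]; exact h.shift n

lemma norm_shift {q a b : ℂ} (hq1 : ‖q‖ < 1) (h : ‖a * q / b‖ < 1) (n : ℕ) :
    ‖a * q ^ n * q / b‖ < 1 := by
  have : a * q ^ n * q / b = a * q / b * q ^ n := by ring
  rw [this, norm_mul, norm_pow]
  have : ‖q‖ ^ n ≤ 1 := pow_le_one₀ (norm_nonneg _) hq1.le
  nlinarith [norm_nonneg (a * q / b), pow_nonneg (norm_nonneg q) n]

lemma recur (q a b c d : ℂ) (hq1 : ‖q‖ < 1) (hb0 : b ≠ 0) (hc0 : c ≠ 0) (hd0 : d ≠ 0)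
    (hb : NZ q (a * q / b)) (hc : NZ q (a * q / c)) (hd : NZ q (a * q / d))
    (hz : ‖a * q / (b * c * d)‖ < 1) :
    ∑' k, T q a b c d k = rho q a b c d * ∑' k, T q (a * q) b c d k := by
  have s1 := T_summable q a b c d hq1 hb hc hd hz
  have s2 : Summable (T q (a * q) b c d) := by
    have hb1 := hb.shift1 1
    have hc1 := hc.shift1 1
    have hd1 := hd.shift1 1
    have hz1 := norm_shift hq1 hz 1
    rw [pow_one] at hb1 hc1 hd1 hz1
    exact T_summable q (a * q) b c d hq1 hb1 hc1 hd1 hz1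
  have s3 := s1.hasSum.sub (s2.hasSum.mul_left (rho q a b c d))
  have l1 := s3.tendsto_sum_nat.comp (Filter.tendsto_add_atTop_nat 1)
  have l2 : Filter.Tendsto (fun n : ℕ => ∑ k ∈ Finset.range (n + 1),
      (T q a b c d k - rho q a b c d * T q (a * q) b c d k)) Filter.atTop (nhds 0) := by
    simp only [sum_eq q a b c d hq1 hb0 hc0 hd0 hb hc hd (NZ_of_lt hq1 hz)]
    exact G_tendsto q a b c d hq1 hb hc hd hz
  exact sub_eq_zero.1 (tendsto_nhds_unique l1 l2)

lemma iter (q a b c d : ℂ) (hq1 : ‖q‖ < 1) (hb0 : b ≠ 0) (hc0 : c ≠ 0) (hd0 : d ≠ 0)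
    (hb : NZ q (a * q / b)) (hc : NZ q (a * q / c)) (hd : NZ q (a * q / d))
    (hz : ‖a * q / (b * c * d)‖ < 1) (n : ℕ) :
    ∑' k, T q a b c d k =
      qPochNat q (a * q) n * qPochNat q (a * q / (b * c)) n * qPochNat q (a * q / (b * d)) n *
          qPochNat q (a * q / (c * d)) n /
        (qPochNat q (a * q / b) n * qPochNat q (a * q / c) n * qPochNat q (a * q / d) n *
          qPochNat q (a * q / (b * c * d)) n) * ∑' k, T q (a * q ^ n) b c d k := by
  induction n with
  | zero => simp [P_zero]
  | succ n ih =>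
    rw [ih, recur q (a * q ^ n) b c d hq1 hb0 hc0 hd0 (hb.shift1 n) (hc.shift1 n) (hd.shift1 n)
      (norm_shift hq1 hz n), rho]
    have e1 : a * q ^ n * q = a * q * q ^ n := by ring
    have e2 : a * q ^ (n + 1) = a * q * q ^ n := by ring
    have e (x : ℂ) : a * q * q ^ n / x = a * q / x * q ^ n := by ring
    simp only [P_succ, e1, e2, e]
    rw [← mul_assoc, div_mul_div_comm]
    congr 2 <;> ring

lemma limT (q a b c d : ℂ) (hq1 : ‖q‖ < 1)
    (hb : NZ q (a * q / b)) (hc : NZ q (a * q / c)) (hd : NZ q (a * q / d))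
    (hz : ‖a * q / (b * c * d)‖ < 1) :
    Filter.Tendsto (fun n : ℕ => ∑' k, T q (a * q ^ n) b c d k) Filter.atTop (nhds 1) := by
  obtain ⟨C, p, h⟩ := T_bound q a b c d hq1 hb hc hd
  have key := tendsto_tsum_of_dominated_convergence (𝓕 := Filter.atTop)
    (f := fun n k => T q (a * q ^ n) b c d k) (g := fun k : ℕ => if k = 0 then (1 : ℂ) else 0)
    (bound := fun k => C * ‖a * q / (b * c * d)‖ ^ k)
    ((summable_geometric_of_lt_one (norm_nonneg _) hz).mul_left C) ?_ ?_
  · simpa using key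
  · intro k
    cases k with
    | zero => simp [T]
    | succ k =>
      simp only [Nat.succ_ne_zero, if_false]
      refine squeeze_zero_norm (fun n => h n (k + 1)) ?_
      have h1 := (((q_pow_tendsto q hq1).const_mul (a * q / (b * c * d))).norm.pow
        (k + 1)).const_mul C
      simpa using h1
  · refine Filter.Eventually.of_forall fun n k => (h n k).trans ?_
    rw [norm_mul, norm_pow]
    have : ‖q‖ ^ n ≤ 1 := pow_le_one₀ (norm_nonneg _) hq1.le
    gcongr
    exact mul_le_of_le_one_right (norm_nonneg _) this

lemma NZ_of_hyp {q x : ℂ} (hq : q ≠ 0) (h : ∀ j : ℕ, x ≠ q ^ (-(j : ℤ))) : NZ q x := fun j h0 => by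
  apply h j
  rw [zpow_neg, zpow_natCast]
  exact eq_inv_of_mul_eq_one_left (sub_eq_zero.1 h0).symm

lemma term_eq (q a b c d : ℂ) (ha1 : a ≠ 1) (k : ℕ) :
    (1 - a * q ^ (2 * k)) / (1 - a) *
        (qPochNat q a k * qPochNat q b k * qPochNat q c k * qPochNat q d k /
          (qPochNat q q k * qPochNat q (a * q / b) k * qPochNat q (a * q / c) k *
            qPochNat q (a * q / d) k)) *
        (a * q / (b * c * d)) ^ k = T q a b c d k := by
  have h : 1 - a ≠ 0 := sub_ne_zero.2 ha1.symm
  cases k with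
  | zero => simp [T, P_zero, h]
  | succ k =>
    rw [T, H, P_succ' q a k, div_eq_mul_inv, div_eq_mul_inv]
    simp only [mul_inv]
    generalize a * q / (b * c * d) = z
    generalize (qPochNat q (a * q / b) (k + 1))⁻¹ = j2
    generalize (qPochNat q (a * q / c) (k + 1))⁻¹ = j3
    generalize (qPochNat q (a * q / d) (k + 1))⁻¹ = j4
    generalize (qPochNat q q (k + 1))⁻¹ = j1
    generalize 1 - a * q ^ (2 * (k + 1)) = y
    generalize 1 - a = x at *
    field_simp

end RogersAux


/-- Rogers' nonterminating ₆φ₅ summation. -/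
theorem rogers_six_phi_five (q a b c d : ℂ)
    (hq0 : 0 < ‖q‖) (hq1 : ‖q‖ < 1)
    (ha : a ≠ 0) (hb : b ≠ 0) (hc : c ≠ 0) (hd : d ≠ 0)
    (ha1 : a ≠ 1)
    (harg : ‖a * q / (b * c * d)‖ < 1)
    (hb' : ∀ j : ℕ, a * q / b ≠ q ^ (-(j : ℤ)))
    (hc' : ∀ j : ℕ, a * q / c ≠ q ^ (-(j : ℤ)))
    (hd' : ∀ j : ℕ, a * q / d ≠ q ^ (-(j : ℤ))) :
    ∑' k : ℕ, (1 - a * q ^ (2 * k)) / (1 - a) *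
        (qPochNat q a k * qPochNat q b k * qPochNat q c k * qPochNat q d k /
          (qPochNat q q k * qPochNat q (a * q / b) k * qPochNat q (a * q / c) k *
            qPochNat q (a * q / d) k)) *
        (a * q / (b * c * d)) ^ k =
      qPochInf q (a * q) * qPochInf q (a * q / (b * c)) * qPochInf q (a * q / (b * d)) *
          qPochInf q (a * q / (c * d)) /
        (qPochInf q (a * q / b) * qPochInf q (a * q / c) * qPochInf q (a * q / d) *
          qPochInf q (a * q / (b * c * d))) := by
  have hq : q ≠ 0 := norm_pos_iff.1 hq0
  have nb := RogersAux.NZ_of_hyp hq hb'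
  have nc := RogersAux.NZ_of_hyp hq hc'
  have nd := RogersAux.NZ_of_hyp hq hd'
  have nz := RogersAux.NZ_of_lt hq1 harg
  simp only [RogersAux.term_eq q a b c d ha1]
  have ib := RogersAux.PInf_ne q _ hq1 nb
  have ic := RogersAux.PInf_ne q _ hq1 nc
  have id' := RogersAux.PInf_ne q _ hq1 nd
  have iz := RogersAux.PInf_ne q _ hq1 nz
  have t := fun x => RogersAux.P_tendsto q x hq1
  have hl := (((((t (a * q)).mul (t (a * q / (b * c)))).mul (t (a * q / (b * d)))).mul
    (t (a * q / (c * d)))).div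
    ((((t (a * q / b)).mul (t (a * q / c))).mul (t (a * q / d))).mul (t (a * q / (b * c * d))))
    (mul_ne_zero (mul_ne_zero (mul_ne_zero ib ic) id') iz)).mul
    (RogersAux.limT q a b c d hq1 nb nc nd harg)
  rw [mul_one] at hl
  refine tendsto_nhds_unique (tendsto_const_nhds (x := ∑' k, RogersAux.T q a b c d k)
    (f := Filter.atTop (α := ℕ))) (hl.congr fun n => ?_)
  exact (RogersAux.iter q a b c d hq1 hb hc hd nb nc nd harg n).symm
end

section
/- F. H. Jackson's terminating ₈φ₇ summation: Let q, a, b, c, d ∈ ℂ with 0 < |q| < 1, a, b, c, d ≠ 0, a ≠ 1, and let n be a nonnegative integer. Assume that for 0 ≤ k ≤ n none of the factors (q;q)_k, (aq/b;q)_k, (aq/c;q)_k, (aq/d;q)_k, (bcd q^{-n}/a;q)_k, (a q^{1+n};q)_k, and none of (aq/b;q)_n, (aq/c;q)_n, (aq/d;q)_n, (aq/(bcd);q)_n vanishes. Then ∑_{k=0}^{n} ( (1 - a q^{2k}) / (1 - a) ) · ( (a;q)_k (b;q)_k (c;q)_k (d;q)_k (a²q^{1+n}/(bcd);q)_k (q^{-n};q)_k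 / ( (q;q)_k (aq/b;q)_k (aq/c;q)_k (aq/d;q)_k (bcd q^{-n}/a;q)_k (a q^{1+n};q)_k ) ) · q^k = (aq;q)_n (aq/(bc);q)_n (aq/(bd);q)_n (aq/(cd);q)_n / ( (aq/b;q)_n (aq/c;q)_n (aq/d;q)_n (aq/(bcd);q)_n ). -/
theorem qP_succ (q x : ℂ) (k : ℕ) : qPochNat q x (k+1) = qPochNat q x k * (1 - x * q^k) := by
  simp [qPochNat, Finset.prod_range_succ]

theorem mul6 (a b c d e f u v w x y z : ℂ) :
    (a*u)*(b*v)*(c*w)*(d*x)*(e*y)*(f*z) = (a*b*c*d*e*f)*(u*v*w*x*y*z) := by ring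

theorem qP_zero (q x : ℂ) : qPochNat q x 0 = 1 := by simp [qPochNat]

theorem qP_shift (q x : ℂ) (k : ℕ) :
    (1 - x) * qPochNat q (x*q) k = qPochNat q x k * (1 - x * q^k) := by
  rw [← qP_succ, qPochNat, qPochNat, Finset.prod_range_succ']
  simp only [pow_zero, mul_one, pow_succ]
  rw [mul_comm]
  congr 1
  exact Finset.prod_congr rfl fun j _ => by ring

theorem qP_ne (q x : ℂ) (k : ℕ) (h : ∀ j : ℕ, 1 - x * q^j ≠ 0) : qPochNat q x k ≠ 0 :=
  Finset.prod_ne_zero_iff.2 fun j _ => h j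

theorem key_id (a b c d e g y : ℂ) (hb : b ≠ 0) (hc : c ≠ 0) (hd : d ≠ 0)
    (hg : g ≠ 0) (ha : a ≠ 0) (h : e = a^2 / (b*c*d*g)) :
    (g - e) * ((1-a*y)*(1-b*y)*(1-c*y)*(1-d*y)*(1-e*y)*(1-g*y)
      - (1-y)*(1-a*y/b)*(1-a*y/c)*(1-a*y/d)*(1-a*y/e)*(1-a*y/g))
    = y*(1-a*y^2)*(g*(1-g)*(1-a/(b*g))*(1-a/(c*g))*(1-a/(d*g))*((1-e*y)*(1-a*y/e))
      - e*(1-e)*(1-a/(b*e))*(1-a/(c*e))*(1-a/(d*e))*((1-g*y)*(1-a*y/g))) := by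
  subst h
  field_simp
  ring

/-- the six-parameter quotient -/
noncomputable def hTerm (q a b c d e g : ℂ) (k : ℕ) : ℂ :=
  qPochNat q a k * qPochNat q b k * qPochNat q c k * qPochNat q d k * qPochNat q e k * qPochNat q g k /
  (qPochNat q q k * qPochNat q (a*q/b) k * qPochNat q (a*q/c) k * qPochNat q (a*q/d) k
    * qPochNat q (a*q/e) k * qPochNat q (a*q/g) k)

theorem tele (q a b c d e g : ℂ) (hb : b ≠ 0) (hc : c ≠ 0) (hd : d ≠ 0)
    (hg : g ≠ 0) (ha : a ≠ 0) (h : e = a^2 / (b*c*d*g))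
    (n0 : ∀ j : ℕ, 1 - q * q^j ≠ 0) (n1 : ∀ j : ℕ, 1 - a*q/b * q^j ≠ 0)
    (n2 : ∀ j : ℕ, 1 - a*q/c * q^j ≠ 0) (n3 : ∀ j : ℕ, 1 - a*q/d * q^j ≠ 0)
    (n4 : ∀ j : ℕ, 1 - a*q/e * q^j ≠ 0) (n5 : ∀ j : ℕ, 1 - a*q/g * q^j ≠ 0) (m : ℕ) :
    ∑ k ∈ Finset.range m, hTerm q a b c d e g k * (q^k*(1-a*(q^k)^2)*
      (g*(1-g)*(1-a/(b*g))*(1-a/(c*g))*(1-a/(d*g))*((1-e*q^k)*(1-a*q^k/e))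
      - e*(1-e)*(1-a/(b*e))*(1-a/(c*e))*(1-a/(d*e))*((1-g*q^k)*(1-a*q^k/g))))
    = (g - e) * (hTerm q a b c d e g m * ((1-q^m)*(1-a*q^m/b)*(1-a*q^m/c)*(1-a*q^m/d)*(1-a*q^m/e)*(1-a*q^m/g))) := by
  induction m with
  | zero => simp
  | succ m ih =>
    rw [Finset.sum_range_succ, ih, ← key_id a b c d e g (q^m) hb hc hd hg ha h]
    have hs : hTerm q a b c d e g (m+1) * ((1-q^(m+1))*(1-a*q^(m+1)/b)*(1-a*q^(m+1)/c)*(1-a*q^(m+1)/d)*(1-a*q^(m+1)/e)*(1-a*q^(m+1)/g))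
      = hTerm q a b c d e g m * ((1-a*q^m)*(1-b*q^m)*(1-c*q^m)*(1-d*q^m)*(1-e*q^m)*(1-g*q^m)) := by
      have e0 : 1 - q^(m+1) = 1 - q * q^m := by ring
      have ex : ∀ x, 1 - a*q^(m+1)/x = 1 - a*q/x*q^m := fun x => by ring
      unfold hTerm
      simp only [e0, ex, qP_succ]
      have hZ : (1 - q*q^m) * (1 - a*q/b*q^m) * (1 - a*q/c*q^m) * (1 - a*q/d*q^m) *
          (1 - a*q/e*q^m) * (1 - a*q/g*q^m) ≠ 0 :=
        mul_ne_zero (mul_ne_zero (mul_ne_zero (mul_ne_zero (mul_ne_zero (n0 m) (n1 m)) (n2 m))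
          (n3 m)) (n4 m)) (n5 m)
      have aux : ∀ N X D Z : ℂ, Z ≠ 0 → N*X/(D*Z)*Z = N/D*X := by
        intro N X D Z hZ
        rw [mul_div_mul_comm, mul_assoc, div_mul_cancel₀ _ hZ]
      refine Eq.trans ?_ (aux _ _ _ _ hZ)
      refine congrArg₂ (· * ·) (congrArg₂ (· / ·) ?_ ?_) rfl
      · exact mul6 _ _ _ _ _ _ _ _ _ _ _ _
      · exact mul6 _ _ _ _ _ _ _ _ _ _ _ _
    rw [hs]; ring

/-- the summand with general last parameters -/
noncomputable def tt (q a b c d e g : ℂ) (k : ℕ) : ℂ :=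
  (1 - a * q ^ (2 * k)) / (1 - a) *
        (qPochNat q a k * qPochNat q b k * qPochNat q c k * qPochNat q d k *
            qPochNat q e k * qPochNat q g k /
          (qPochNat q q k * qPochNat q (a * q / b) k * qPochNat q (a * q / c) k *
            qPochNat q (a * q / d) k * qPochNat q (a * q / e) k *
            qPochNat q (a * q / g) k)) * q ^ k

theorem tt_swap (q a b c d e g : ℂ) (k : ℕ) : tt q a b c d e g k = tt q a b c d g e k := by
  unfold tt; ring

theorem hTerm_swap (q a b c d e g : ℂ) (k : ℕ) :
    hTerm q a b c d e g k = hTerm q a b c d g e k := by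
  unfold hTerm; ring

theorem tt_h (q a b c d e g : ℂ) (k : ℕ) (hq : q ≠ 0) (ha1 : 1 - a ≠ 0)
    (n5 : ∀ j : ℕ, 1 - a/g * q^j ≠ 0) :
    tt q a b c d e (g*q) k * ((1-a)*(1-g)*(1-a/g)) =
      hTerm q a b c d e g k * (q^k*(1-a*(q^k)^2)*((1-g*q^k)*(1-a*q^k/g))) := by
  have h1 := qP_shift q g k
  have h2 := qP_shift q (a/g) k
  have e1 : a*q/(g*q) = a/g := by field_simp
  have e2 : a*q/g = a/g*q := by ring
  have e3 : a*q^k/g = a/g*q^k := by ring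
  have m0 := n5 0
  rw [pow_zero, mul_one] at m0
  have mk := n5 k
  have w := qP_ne q _ k n5
  have w' : qPochNat q (a/g*q) k ≠ 0 := by
    intro h0; rw [h0, mul_zero] at h2
    exact mul_ne_zero w mk h2.symm
  unfold tt hTerm
  rw [e1, e2, e3, pow_mul' q 2 k]
  have h3 : (1 - a/g) / qPochNat q (a/g) k = (1 - a/g*q^k) / qPochNat q (a/g*q) k := by
    rw [div_eq_div_iff w w', h2]; ring
  generalize 1 - a/g*q^k = z1 at *
  generalize 1 - a/g = z2 at *
  generalize qPochNat q (a/g*q) k = z3 at *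
  generalize qPochNat q (a/g) k = z4 at *
  have h4 : (1-a)/(1-a) = 1 := div_self ha1
  simp only [div_eq_mul_inv, mul_inv] at *
  linear_combination (q^k*(1-a*(q^k)^2) * qPochNat q a k * qPochNat q b k * qPochNat q c k *
    qPochNat q d k * qPochNat q e k * (qPochNat q q k)⁻¹ * (qPochNat q (a*q*b⁻¹) k)⁻¹ *
    (qPochNat q (a*q*c⁻¹) k)⁻¹ * (qPochNat q (a*q*d⁻¹) k)⁻¹ * (qPochNat q (a*q*e⁻¹) k)⁻¹) *
    ((1-g) * qPochNat q (g*q) k * z2 * z4⁻¹ * h4 + z2 * z4⁻¹ * h1 +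
      qPochNat q g k * (1 - g*q^k) * h3)

theorem jackson_generic (q a b c d : ℂ) (hq : q ≠ 0) (n0 : ∀ j : ℕ, 1 - q * q^j ≠ 0)
    (ha : a ≠ 0) (hb : b ≠ 0) (hc : c ≠ 0) (hd : d ≠ 0)
    (G1 : ∀ j : ℤ, a * q^j ≠ 1) (Gb : ∀ j : ℤ, a * q^j ≠ b) (Gc : ∀ j : ℤ, a * q^j ≠ c)
    (Gd : ∀ j : ℤ, a * q^j ≠ d) (Gbcd : ∀ j : ℤ, a * q^j ≠ b*c*d)
    (Gs : ∀ j : ℤ, a^2 * q^j ≠ b*c*d) (n : ℕ) :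
    ∑ k ∈ Finset.range (n + 1), tt q a b c d (a ^ 2 * q ^ (n + 1) / (b * c * d)) ((q^n)⁻¹) k =
      qPochNat q (a * q) n * qPochNat q (a * q / (b * c)) n * qPochNat q (a * q / (b * d)) n *
          qPochNat q (a * q / (c * d)) n /
        (qPochNat q (a * q / b) n * qPochNat q (a * q / c) n * qPochNat q (a * q / d) n *
          qPochNat q (a * q / (b * c * d)) n) := by
  have ha1 : 1 - a ≠ 0 := fun h => G1 0 (by rw [zpow_zero]; linear_combination -h)
  have gen : ∀ x : ℂ, x ≠ 0 → (∀ j : ℤ, a * q^j ≠ x) → ∀ j : ℕ, 1 - a*q/x*q^j ≠ 0 := by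
    intro x hx hG j h
    apply hG (j+1)
    rw [zpow_add₀ hq, zpow_natCast, zpow_one]
    field_simp at h
    linear_combination -h
  have gb := gen b hb Gb
  have gc := gen c hc Gc
  have gd := gen d hd Gd
  have gbcd := gen _ (mul_ne_zero (mul_ne_zero hb hc) hd) Gbcd
  induction n with
  | zero => simp [tt, qP_zero, ha1]
  | succ n ih =>
    obtain ⟨g, hgdef⟩ : ∃ g, g = (q^(n+1))⁻¹ := ⟨_, rfl⟩
    obtain ⟨e, hedef⟩ : ∃ e, e = a^2/(b*c*d*g) := ⟨_, rfl⟩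
    have hqn : q^(n+1) ≠ 0 := pow_ne_zero _ hq
    have hg : g ≠ 0 := by rw [hgdef]; exact inv_ne_zero hqn
    have hgq : g * q^(n+1) = 1 := by rw [hgdef]; exact inv_mul_cancel₀ hqn
    have he : e ≠ 0 := by rw [hedef]; positivity
    have e1 : a ^ 2 * q ^ (n + 1) / (b * c * d) = e := by
      rw [hedef, hgdef]; field_simp
    have e2 : (q^n)⁻¹ = g * q := by rw [hgdef]; field_simp; ring
    have e3 : a ^ 2 * q ^ (n + 1 + 1) / (b * c * d) = e * q := by
      rw [← e1]; ring
    have hgz : g = q^(-((n:ℤ)+1)) := by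
      rw [hgdef, zpow_neg]; norm_cast
    have agj : ∀ j : ℕ, 1 - a/g*q^j ≠ 0 := by
      intro j h
      apply G1 ((n:ℤ)+1+j)
      rw [zpow_add₀ hq, zpow_natCast]
      have : q^((n:ℤ)+1) = q^(n+1) := by norm_cast
      rw [this]
      field_simp at h
      linear_combination (-q^(n+1)) * h + hgq
    have aej : ∀ j : ℕ, 1 - a/e*q^j ≠ 0 := by
      intro j h
      apply Gbcd ((n:ℤ)+1-j)
      rw [zpow_sub₀ hq, zpow_natCast]
      have : q^((n:ℤ)+1) = q^(n+1) := by norm_cast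
      rw [this]
      have hj : q^j ≠ 0 := pow_ne_zero _ hq
      rw [← e1] at h
      field_simp at h ⊢
      linear_combination h
    have g1 : 1 - g ≠ 0 := by
      intro h
      have := n0 n
      apply this
      linear_combination (-q^(n+1)) * h - hgq
    have hee : 1 - e ≠ 0 := by
      intro h
      apply Gs ((n:ℤ)+1)
      have : q^((n:ℤ)+1) = q^(n+1) := by norm_cast
      rw [this]
      rw [← e1] at h
      field_simp at h
      linear_combination -h
    have shiftj : ∀ x : ℂ, (∀ j : ℕ, 1 - a/x*q^j ≠ 0) → ∀ j : ℕ, 1 - a*q/x*q^j ≠ 0 := by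
      intro x h j h'
      apply h (j+1)
      linear_combination h'
    have T := tele q a b c d e g hb hc hd hg ha hedef n0 gb gc gd (shiftj e aej) (shiftj g agj)
      (n+1+1)
    have hz : hTerm q a b c d e g (n+1+1) = 0 := by
      unfold hTerm
      rw [qP_succ q g (n+1), hgq]; simp
    rw [hz, zero_mul, mul_zero] at T
    have t1 : ∀ k, tt q a b c d e (g*q) k * ((1-a)*(1-g)*(1-a/g)) =
      hTerm q a b c d e g k * (q^k*(1-a*(q^k)^2)*((1-g*q^k)*(1-a*q^k/g))) :=
      fun k => tt_h q a b c d e g k hq ha1 agj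
    have t2 : ∀ k, tt q a b c d (e*q) g k * ((1-a)*(1-e)*(1-a/e)) =
      hTerm q a b c d e g k * (q^k*(1-a*(q^k)^2)*((1-e*q^k)*(1-a*q^k/e))) := by
      intro k
      rw [tt_swap, hTerm_swap]
      exact tt_h q a b c d g e k hq ha1 aej
    have tl : tt q a b c d e (g*q) (n+1) = 0 := by
      unfold tt
      rw [qP_succ q (g*q) n, show g*q*q^n = 1 by rw [← hgq]; ring]; simp
    rw [e1, e2] at ih
    rw [e3, ← hgdef]
    set S1 := ∑ k ∈ Finset.range (n+1+1), tt q a b c d (e*q) g k with hS1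
    set S0 := ∑ k ∈ Finset.range (n+1), tt q a b c d e (g*q) k with hS0
    have hS0' : S0 = ∑ k ∈ Finset.range (n+1+1), tt q a b c d e (g*q) k := by
      rw [Finset.sum_range_succ, tl, add_zero]
    have hrec : g*(1-g)*(1-a/(b*g))*(1-a/(c*g))*(1-a/(d*g)) * (S1 * ((1-a)*(1-e)*(1-a/e)))
       = e*(1-e)*(1-a/(b*e))*(1-a/(c*e))*(1-a/(d*e)) * (S0 * ((1-a)*(1-g)*(1-a/g))) := by
      rw [hS0', hS1, Finset.sum_mul, Finset.sum_mul, Finset.mul_sum, Finset.mul_sum, ← sub_eq_zero,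
        ← Finset.sum_sub_distrib, ← T]
      apply Finset.sum_congr rfl
      intro k _
      rw [t1, t2]; ring
    have ex : ∀ x : ℂ, a*q/x*q^n = a/(x*g) := by
      intro x; rw [hgdef, div_mul_eq_div_div, div_inv_eq_mul, pow_succ]; ring
    have ex1 : a*q*q^n = a/g := by rw [hgdef, div_inv_eq_mul, pow_succ]; ring
    have fb := gb n
    have fc := gc n
    have fd := gd n
    have fbcd := gbcd n
    rw [ex] at fb fc fd fbcd
    have rec2 : (1-a/(b*g))*(1-a/(c*g))*(1-a/(d*g))*(1-a/(b*c*d*g)) * S1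
       = (1-a/g)*(1-a/(b*c*g))*(1-a/(b*d*g))*(1-a/(c*d*g)) * S0 := by
      have r1 : 1 - a/e = -(b*c*d*g/a)*(1-a/(b*c*d*g)) := by rw [hedef]; field_simp; ring
      have r2 : 1 - a/(b*e) = -(c*d*g/a)*(1-a/(c*d*g)) := by rw [hedef]; field_simp; ring
      have r3 : 1 - a/(c*e) = -(b*d*g/a)*(1-a/(b*d*g)) := by rw [hedef]; field_simp; ring
      have r4 : 1 - a/(d*e) = -(b*c*g/a)*(1-a/(b*c*g)) := by rw [hedef]; field_simp; ring
      rw [r1, r2, r3, r4] at hrec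
      have hK : (1-a)*(1-e)*(1-g)*(b*c*d*g^2/a) ≠ 0 := by
        have : b*c*d*g^2/a ≠ 0 := by positivity
        exact mul_ne_zero (mul_ne_zero (mul_ne_zero ha1 hee) g1) this
      apply mul_left_cancel₀ hK
      have hK2 : e * ((c*d*g/a)*(b*d*g/a)*(b*c*g/a)) = b*c*d*g^2/a := by
        rw [hedef]; field_simp
      linear_combination (-1)*hrec + ((1-e)*(1-a)*(1-g)*(1-a/g)*(1-a/(b*c*g))*(1-a/(b*d*g))*(1-a/(c*d*g)) * S0) * hK2
    rw [ih] at rec2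
    simp only [qP_succ, ex, ex1]
    have := qP_ne q _ n gb
    have := qP_ne q _ n gc
    have := qP_ne q _ n gd
    have := qP_ne q _ n gbcd
    generalize 1-a/(b*g) = z1 at *
    generalize 1-a/(c*g) = z2 at *
    generalize 1-a/(d*g) = z3 at *
    generalize 1-a/(b*c*d*g) = z4 at *
    generalize qPochNat q (a*q/b) n = w1 at *
    generalize qPochNat q (a*q/c) n = w2 at *
    generalize qPochNat q (a*q/d) n = w3 at *
    generalize qPochNat q (a*q/(b*c*d)) n = w4 at *
    field_simp at rec2 ⊢
    linear_combination rec2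

theorem qP_cont (q : ℂ) (f : ℂ → ℂ) (k : ℕ) (x : ℂ) (hf : ContinuousAt f x) :
    ContinuousAt (fun y => qPochNat q (f y) k) x := by
  unfold qPochNat
  fun_prop

theorem bad_countable (q v : ℂ) (hq : q ≠ 0) : {x : ℂ | ∃ j : ℤ, x * q^j = v}.Countable := by
  rw [Set.ofPred_exists]
  refine Set.countable_iUnion fun j => ?_
  refine (Set.countable_singleton (v / q^j)).mono ?_
  intro x hx
  rw [Set.mem_singleton_iff, eq_div_iff (zpow_ne_zero _ hq)]
  exact hx

theorem bad_countable2 (q v : ℂ) (hq : q ≠ 0) : {x : ℂ | ∃ j : ℤ, x^2 * q^j = v}.Countable := by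
  rw [Set.ofPred_exists]
  refine Set.countable_iUnion fun j => ?_
  refine ((Polynomial.nthRoots 2 (v / q^j)).toFinset.finite_toSet.countable).mono ?_
  intro x hx
  have hx' : x^2 * q^j = v := hx
  simp only [Finset.mem_coe, Multiset.mem_toFinset]
  rw [Polynomial.mem_nthRoots (by norm_num), eq_div_iff (zpow_ne_zero _ hq)]
  exact hx'

/-- F. H. Jackson's terminating ₈φ₇ summation. -/
theorem jackson_eight_phi_seven (q a b c d : ℂ) (n : ℕ)
    (hq0 : 0 < ‖q‖) (hq1 : ‖q‖ < 1)
    (ha : a ≠ 0) (hb : b ≠ 0) (hc : c ≠ 0) (hd : d ≠ 0)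
    (ha1 : a ≠ 1)
    (h1 : ∀ k ≤ n, qPochNat q q k ≠ 0)
    (h2 : ∀ k ≤ n, qPochNat q (a * q / b) k ≠ 0)
    (h3 : ∀ k ≤ n, qPochNat q (a * q / c) k ≠ 0)
    (h4 : ∀ k ≤ n, qPochNat q (a * q / d) k ≠ 0)
    (h5 : ∀ k ≤ n, qPochNat q (b * c * d * q ^ (-(n : ℤ)) / a) k ≠ 0)
    (h6 : ∀ k ≤ n, qPochNat q (a * q ^ (n + 1)) k ≠ 0)
    (h7 : qPochNat q (a * q / b) n ≠ 0)
    (h8 : qPochNat q (a * q / c) n ≠ 0)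
    (h9 : qPochNat q (a * q / d) n ≠ 0)
    (h10 : qPochNat q (a * q / (b * c * d)) n ≠ 0) :
    ∑ k ∈ Finset.range (n + 1), (1 - a * q ^ (2 * k)) / (1 - a) *
        (qPochNat q a k * qPochNat q b k * qPochNat q c k * qPochNat q d k *
            qPochNat q (a ^ 2 * q ^ (n + 1) / (b * c * d)) k *
            qPochNat q ((q : ℂ) ^ (-(n : ℤ))) k /
          (qPochNat q q k * qPochNat q (a * q / b) k * qPochNat q (a * q / c) k *
            qPochNat q (a * q / d) k * qPochNat q (b * c * d * q ^ (-(n : ℤ)) / a) k *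
            qPochNat q (a * q ^ (n + 1)) k)) *
        q ^ k =
      qPochNat q (a * q) n * qPochNat q (a * q / (b * c)) n * qPochNat q (a * q / (b * d)) n *
          qPochNat q (a * q / (c * d)) n /
        (qPochNat q (a * q / b) n * qPochNat q (a * q / c) n * qPochNat q (a * q / d) n *
          qPochNat q (a * q / (b * c * d)) n) := by
  have hq : q ≠ 0 := norm_pos_iff.1 hq0
  have n0 : ∀ j : ℕ, 1 - q * q^j ≠ 0 := by
    intro j h
    have h' : q^(j+1) = 1 := by linear_combination -h
    have h2 : ‖q‖^(j+1) = 1 := by rw [← norm_pow, h', norm_one]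
    exact (pow_lt_one₀ hq0.le hq1 (Nat.succ_ne_zero j)).ne h2
  have ha1' : 1 - a ≠ 0 := sub_ne_zero.2 ha1.symm
  have hbcd : b*c*d ≠ 0 := mul_ne_zero (mul_ne_zero hb hc) hd
  have cont_div : ∀ z w : ℂ, ContinuousAt (fun x : ℂ => x * w / z) a := fun z w => by
    simp only [div_eq_mul_inv]; fun_prop
  have hL : ContinuousAt (fun a : ℂ => ∑ k ∈ Finset.range (n + 1),
        (1 - a * q ^ (2 * k)) / (1 - a) *
        (qPochNat q a k * qPochNat q b k * qPochNat q c k * qPochNat q d k *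
            qPochNat q (a ^ 2 * q ^ (n + 1) / (b * c * d)) k *
            qPochNat q ((q : ℂ) ^ (-(n : ℤ))) k /
          (qPochNat q q k * qPochNat q (a * q / b) k * qPochNat q (a * q / c) k *
            qPochNat q (a * q / d) k * qPochNat q (b * c * d * q ^ (-(n : ℤ)) / a) k *
            qPochNat q (a * q ^ (n + 1)) k)) *
        q ^ k) a := by
    refine tendsto_finsetSum _ fun k hk => ?_
    have hk' : k ≤ n := Nat.lt_succ_iff.1 (Finset.mem_range.1 hk)
    have c1 := qP_cont q (fun x => x) k a continuousAt_id
    have c2 := qP_cont q (fun x => x ^ 2 * q ^ (n + 1) / (b * c * d)) k a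
      (by simp only [div_eq_mul_inv]; fun_prop)
    have c3 := qP_cont q (fun x => x * q / b) k a (cont_div _ _)
    have c4 := qP_cont q (fun x => x * q / c) k a (cont_div _ _)
    have c5 := qP_cont q (fun x => x * q / d) k a (cont_div _ _)
    have c6 := qP_cont q (fun x => b * c * d * q ^ (-(n : ℤ)) / x) k a
      (continuousAt_const.div continuousAt_id ha)
    have c7 := qP_cont q (fun x => x * q ^ (n + 1)) k a (by fun_prop)
    have c8 : ContinuousAt (fun x : ℂ => (1 - x * q ^ (2 * k)) / (1 - x)) a :=
      ContinuousAt.div (by fun_prop) (by fun_prop) ha1'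
    refine ContinuousAt.mul (ContinuousAt.mul c8 (ContinuousAt.div ?_ ?_ ?_)) continuousAt_const
    · exact (((((c1.mul continuousAt_const).mul continuousAt_const).mul continuousAt_const).mul
        c2).mul continuousAt_const)
    · exact (((((continuousAt_const.mul c3).mul c4).mul c5).mul c6).mul c7)
    · exact mul_ne_zero (mul_ne_zero (mul_ne_zero (mul_ne_zero (mul_ne_zero (h1 k hk') (h2 k hk'))
        (h3 k hk')) (h4 k hk')) (h5 k hk')) (h6 k hk')
  have hR : ContinuousAt (fun a : ℂ =>
      qPochNat q (a * q) n * qPochNat q (a * q / (b * c)) n * qPochNat q (a * q / (b * d)) n *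
          qPochNat q (a * q / (c * d)) n /
        (qPochNat q (a * q / b) n * qPochNat q (a * q / c) n * qPochNat q (a * q / d) n *
          qPochNat q (a * q / (b * c * d)) n)) a := by
    have cc := fun z => qP_cont q (fun x => x * q / z) n a (cont_div z q)
    have c0 := qP_cont q (fun x => x * q) n a (by fun_prop)
    exact (((c0.mul (cc _)).mul (cc _)).mul (cc _)).div ((((cc _).mul (cc _)).mul (cc _)).mul (cc _))
      (mul_ne_zero (mul_ne_zero (mul_ne_zero h7 h8) h9) h10)
  have hcount := ((((((bad_countable q 1 hq).union (bad_countable q b hq)).union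
    (bad_countable q c hq)).union (bad_countable q d hq)).union
    (bad_countable q (b*c*d) hq)).union (bad_countable2 q (b*c*d) hq)).union
    (Set.countable_singleton (0:ℂ))
  have hdense := hcount.dense_compl ℂ
  have hfr := mem_closure_iff_frequently.1 (hdense a)
  rw [← sub_eq_zero]
  have hsub := hL.sub hR
  refine isClosed_singleton.mem_of_frequently_of_tendsto (hfr.mono ?_) hsub
  intro x hx
  simp only [Set.mem_compl_iff, Set.mem_union, Set.mem_ofPred_eq, Set.mem_singleton_iff, not_or,
    not_exists] at hx
  obtain ⟨⟨⟨⟨⟨⟨x1, x2⟩, x3⟩, x4⟩, x5⟩, x6⟩, x0⟩ := hx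
  have J := jackson_generic q x b c d hq n0 x0 hb hc hd x1 x2 x3 x4 x5 x6 n
  rw [Set.mem_singleton_iff, Pi.sub_apply, sub_eq_zero, ← J]
  refine Finset.sum_congr rfl fun k _ => ?_
  have hqn : q^n ≠ 0 := pow_ne_zero _ hq
  have e1 : x * q / (x ^ 2 * q ^ (n + 1) / (b * c * d)) = b * c * d * q ^ (-(n : ℤ)) / x := by
    rw [zpow_neg, zpow_natCast]; field_simp; ring
  have e2 : x * q / (q^n)⁻¹ = x * q^(n+1) := by rw [div_inv_eq_mul]; ring
  unfold tt
  rw [e1, e2, zpow_neg, zpow_natCast]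
end

section
/- Heine's q-Gauss summation: Let q, a, b, c ∈ ℂ with 0 < |q| < 1, a, b ≠ 0, and |c/(ab)| < 1. Assume c ≠ q^{-j} for every j ≥ 0 (so (c;q)_k ≠ 0 for all k ≥ 0 and (c;q)_∞ ≠ 0). Then ∑_{k=0}^{∞} ( (a;q)_k (b;q)_k / ( (q;q)_k (c;q)_k ) ) (c/(ab))^k = (c/a;q)_∞ (c/b;q)_∞ / ( (c;q)_∞ (c/(ab);q)_∞ ). -/
open Filter Topology in
lemma aux_tendsto (q x : ℂ) (hq1 : ‖q‖ < 1) :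
    Tendsto (fun n => qPochNat q x n) atTop (𝓝 (qPochInf q x)) := by
  have hs : Summable fun j : ℕ => ‖-(x * q ^ j)‖ := by
    simp only [norm_neg, norm_mul, norm_pow]
    exact (summable_geometric_of_lt_one (norm_nonneg _) hq1).mul_left _
  have h := (multipliable_one_add_of_summable hs).hasProd.tendsto_prod_nat
  simpa [qPochNat, qPochInf, sub_eq_add_neg] using h

lemma aux_ne (q x : ℂ) (hq1 : ‖q‖ < 1) (h : ∀ j : ℕ, 1 - x * q ^ j ≠ 0) :
    qPochInf q x ≠ 0 := by
  have hs : Summable fun j : ℕ => ‖-(x * q ^ j)‖ := by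
    simp only [norm_neg, norm_mul, norm_pow]
    exact (summable_geometric_of_lt_one (norm_nonneg _) hq1).mul_left _
  have := tprod_one_add_ne_zero_of_summable (f := fun j : ℕ => -(x * q ^ j))
    (fun j => by simpa [sub_eq_add_neg] using h j) hs
  simpa [qPochInf, sub_eq_add_neg] using this

lemma aux_nat_ne (q x : ℂ) (h : ∀ j : ℕ, 1 - x * q ^ j ≠ 0) (k : ℕ) :
    qPochNat q x k ≠ 0 := Finset.prod_ne_zero_iff.mpr fun j _ => h j

lemma aux_upper (q x : ℂ) (hq1 : ‖q‖ < 1) : ∃ M : ℝ, 0 < M ∧ ∀ k, ‖qPochNat q x k‖ ≤ M := by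
  obtain ⟨M, hM⟩ := (aux_tendsto q x hq1).norm.bddAbove_range
  refine ⟨max M 1, by positivity, fun k => le_max_of_le_left (hM ⟨k, rfl⟩)⟩

lemma aux_lower (q x : ℂ) (hq1 : ‖q‖ < 1) (h : ∀ j : ℕ, 1 - x * q ^ j ≠ 0) :
    ∃ M : ℝ, 0 < M ∧ ∀ k, ‖(qPochNat q x k)⁻¹‖ ≤ M := by
  obtain ⟨M, hM⟩ := ((aux_tendsto q x hq1).inv₀ (aux_ne q x hq1 h)).norm.bddAbove_range
  refine ⟨max M 1, by positivity, fun k => le_max_of_le_left (hM ⟨k, rfl⟩)⟩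

lemma aux_shift (q x : ℂ) (n k : ℕ) :
    qPochNat q x (n + k) = qPochNat q x n * qPochNat q (x * q ^ n) k := by
  simp only [qPochNat, Finset.prod_range_add]
  congr 1
  exact Finset.prod_congr rfl fun j _ => by ring

/-- The summand. -/
noncomputable def qgT (q a b c : ℂ) (k : ℕ) : ℂ :=
  qPochNat q a k * qPochNat q b k / (qPochNat q q k * qPochNat q c k) * (c / (a * b)) ^ k

lemma aux_q_ne (q : ℂ) (hq1 : ‖q‖ < 1) (x : ℂ) (hx : ‖x‖ < 1) (j : ℕ) : 1 - x * q ^ j ≠ 0 := by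
  intro h
  have h1 : x * q ^ j = 1 := (sub_eq_zero.mp h).symm
  have h2 : ‖x‖ * ‖q‖ ^ j = 1 := by rw [← norm_pow, ← norm_mul, h1, norm_one]
  have h3 : ‖q‖ ^ j ≤ 1 := pow_le_one₀ (norm_nonneg _) hq1.le
  nlinarith [norm_nonneg x, norm_nonneg q, pow_nonneg (norm_nonneg q) j]

lemma aux_bound (q a b c : ℂ) (hq1 : ‖q‖ < 1) (h : ∀ j : ℕ, 1 - c * q ^ j ≠ 0) :
    ∃ C : ℝ, ∀ n k, ‖qgT q a b (c * q ^ n) k‖ ≤ C * (‖c / (a * b)‖ * ‖q‖ ^ n) ^ k := by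
  obtain ⟨A, hA, hA'⟩ := aux_upper q a hq1
  obtain ⟨B, hB, hB'⟩ := aux_upper q b hq1
  obtain ⟨D, hD, hD'⟩ := aux_upper q c hq1
  obtain ⟨E, hE, hE'⟩ := aux_lower q q hq1 (aux_q_ne q hq1 q hq1)
  obtain ⟨F, hF, hF'⟩ := aux_lower q c hq1 h
  refine ⟨A * B * (E * (D * F)), fun n k => ?_⟩
  have h1 : (qPochNat q (c * q ^ n) k)⁻¹ = qPochNat q c n * (qPochNat q c (n + k))⁻¹ := by
    have := aux_nat_ne q c h n
    rw [aux_shift, mul_inv, mul_inv_cancel_left₀ this]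
  have h2 : c * q ^ n / (a * b) = c / (a * b) * q ^ n := by ring
  rw [qgT, h2, div_eq_mul_inv, mul_inv, h1]
  simp only [norm_mul, norm_pow]
  gcongr
  · exact hA' k
  · exact hB' k
  · exact hE' k
  · exact hD' n
  · exact hF' _

lemma aux_summable (q a b c : ℂ) (hq1 : ‖q‖ < 1) (h : ∀ j : ℕ, 1 - c * q ^ j ≠ 0)
    (harg : ‖c / (a * b)‖ < 1) : Summable (qgT q a b c) := by
  obtain ⟨C, hC⟩ := aux_bound q a b c hq1 h
  refine Summable.of_norm_bounded
    ((summable_geometric_of_lt_one (norm_nonneg _) harg).mul_left C) fun k => ?_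
  simpa using hC 0 k

open Filter Topology in
lemma aux_rec (q a b c : ℂ) (hq1 : ‖q‖ < 1) (ha : a ≠ 0) (hb : b ≠ 0)
    (h : ∀ j : ℕ, 1 - c * q ^ j ≠ 0) (harg : ‖c / (a * b)‖ < 1) :
    (1 - c) * (1 - c / (a * b)) * ∑' k, qgT q a b c k =
      (1 - c / a) * (1 - c / b) * ∑' k, qgT q a b (c * q) k := by
  have hs := aux_summable q a b c hq1 h harg
  have h' : ∀ j : ℕ, 1 - (c * q) * q ^ j ≠ 0 := fun j => by
    have := h (j + 1); rwa [pow_succ', ← mul_assoc] at this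
  have harg' : ‖c * q / (a * b)‖ < 1 := by
    have : c * q / (a * b) = c / (a * b) * q := by ring
    rw [this, norm_mul]
    nlinarith [norm_nonneg q, norm_nonneg (c / (a * b))]
  have hs' := aux_summable q a b (c * q) hq1 h' harg'
  have hg : Tendsto (fun k => -(1 - c) * (1 - q ^ k) * qgT q a b c k) atTop (𝓝 0) := by
    have h1 := (tendsto_pow_atTop_nhds_zero_of_norm_lt_one hq1)
    have := ((h1.const_sub 1).const_mul (-(1 - c))).mul hs.tendsto_atTop_zero
    simpa using this
  have key : ∀ k, (1 - c) * (1 - c / (a * b)) * qgT q a b c k -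
      (1 - c / a) * (1 - c / b) * qgT q a b (c * q) k =
      -(1 - c) * (1 - q ^ (k + 1)) * qgT q a b c (k + 1)
        - -(1 - c) * (1 - q ^ k) * qgT q a b c k := by
    intro k
    have e1 : qPochNat q c (k + 1) = (1 - c) * qPochNat q (c * q) k := by
      rw [add_comm, aux_shift]; simp [qPochNat]
    have e2 : qPochNat q c (k + 1) = qPochNat q c k * (1 - c * q ^ k) := by
      simp [qPochNat, Finset.prod_range_succ]
    have e3 : qPochNat q q (k + 1) = qPochNat q q k * (1 - q ^ (k + 1)) := by
      simp [qPochNat, Finset.prod_range_succ, pow_succ']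
    have e4 : ∀ x, qPochNat q x (k + 1) = qPochNat q x k * (1 - x * q ^ k) := by
      simp [qPochNat, Finset.prod_range_succ]
    have hc1 : 1 - c ≠ 0 := by simpa using h 0
    have hck := h k
    have n1 := aux_nat_ne q c h k
    have n2 := aux_nat_ne q q (aux_q_ne q hq1 q hq1) k
    have n3 : 1 - q ^ (k + 1) ≠ 0 := by
      have := aux_q_ne q hq1 q hq1 k
      rwa [← pow_succ'] at this
    have e5 : qPochNat q (c * q) k = qPochNat q c k * (1 - c * q ^ k) / (1 - c) := by
      rw [eq_div_iff hc1, ← e2, e1]; ring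
    have t1 : qgT q a b (c * q) k = qgT q a b c k * (q ^ k * (1 - c) / (1 - c * q ^ k)) := by
      have h2 : c * q / (a * b) = c / (a * b) * q := by ring
      rw [qgT, qgT, e5, h2, mul_pow]
      generalize c / (a * b) = z
      generalize qPochNat q c k = y at *
      field_simp
    have t2 : (1 - q ^ (k + 1)) * qgT q a b c (k + 1) = qgT q a b c k *
        ((1 - a * q ^ k) * (1 - b * q ^ k) * (c / (a * b)) / (1 - c * q ^ k)) := by
      rw [qgT, qgT, e2, e3, e4 a, e4 b, pow_succ (c / (a * b))]
      generalize c / (a * b) = z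
      generalize 1 - q ^ (k + 1) = w at *
      generalize 1 - c * q ^ k = v at *
      field_simp
    rw [mul_assoc (-(1 - c)) _ (qgT q a b c (k + 1)), t1, t2]
    generalize qgT q a b c k = t
    generalize q ^ k = Q at *
    have : (1 - c / (a * b)) - (1 - c / a) * (1 - c / b) * (Q / (1 - c * Q)) =
      - ((1 - a * Q) * (1 - b * Q) * (c / (a * b)) / (1 - c * Q)) + (1 - Q) := by
      field_simp
      ring
    linear_combination (1 - c) * t * this
  have hsum : HasSum (fun k => (1 - c) * (1 - c / (a * b)) * qgT q a b c k -
      (1 - c / a) * (1 - c / b) * qgT q a b (c * q) k) _ :=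
    (hs.hasSum.mul_left _).sub (hs'.hasSum.mul_left _)
  have h0 := hsum.tendsto_sum_nat
  simp only [key, Finset.sum_range_sub
    (fun k => -(1 - c) * (1 - q ^ k) * qgT q a b c k)] at h0
  have h1 := tendsto_nhds_unique h0 (hg.sub_const _)
  simp only [pow_zero] at h1
  linear_combination h1

lemma aux_iter (q a b c : ℂ) (hq1 : ‖q‖ < 1) (ha : a ≠ 0) (hb : b ≠ 0)
    (h : ∀ j : ℕ, 1 - c * q ^ j ≠ 0) (harg : ‖c / (a * b)‖ < 1) (n : ℕ) :
    qPochNat q c n * qPochNat q (c / (a * b)) n * ∑' k, qgT q a b c k =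
      qPochNat q (c / a) n * qPochNat q (c / b) n * ∑' k, qgT q a b (c * q ^ n) k := by
  induction n with
  | zero => simp [qPochNat]
  | succ n ih =>
    have e4 : ∀ x, qPochNat q x (n + 1) = qPochNat q x n * (1 - x * q ^ n) := by
      simp [qPochNat, Finset.prod_range_succ]
    have r := aux_rec q a b (c * q ^ n) hq1 ha hb (fun j => by
      have := h (n + j); rwa [pow_add, ← mul_assoc] at this) (by
      have : c * q ^ n / (a * b) = c / (a * b) * q ^ n := by ring
      rw [this, norm_mul, norm_pow]
      have h3 : ‖q‖ ^ n ≤ 1 := pow_le_one₀ (norm_nonneg _) hq1.le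
      nlinarith [norm_nonneg (c / (a * b)), pow_nonneg (norm_nonneg q) n])
    rw [show c * q ^ n * q = c * q ^ (n + 1) by ring] at r
    simp only [e4]
    linear_combination (1 - c * q ^ n) * (1 - c / (a * b) * q ^ n) * ih +
      qPochNat q (c / a) n * qPochNat q (c / b) n * r

open Filter Topology in
lemma aux_lim (q a b c : ℂ) (hq1 : ‖q‖ < 1)
    (h : ∀ j : ℕ, 1 - c * q ^ j ≠ 0) (harg : ‖c / (a * b)‖ < 1) :
    Tendsto (fun n : ℕ => ∑' k, qgT q a b (c * q ^ n) k) atTop (𝓝 1) := by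
  obtain ⟨C, hC⟩ := aux_bound q a b c hq1 h
  have hC0 : 0 ≤ C := by
    have := (norm_nonneg _).trans (hC 0 0); simpa using this
  have e : (1 : ℂ) = ∑' k : ℕ, if k = 0 then 1 else 0 := by simp
  rw [e]
  refine tendsto_tsum_of_dominated_convergence (bound := fun k => C * ‖c / (a * b)‖ ^ k)
    ((summable_geometric_of_lt_one (norm_nonneg _) harg).mul_left C) ?_ ?_
  · intro k
    rcases k with _ | k
    · simp [qgT, qPochNat]
    · simp only [Nat.add_eq_zero_iff, one_ne_zero, and_false, if_false]
      refine squeeze_zero_norm (fun n => hC n (k + 1)) ?_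
      have h1 := tendsto_pow_atTop_nhds_zero_of_lt_one (norm_nonneg q) hq1
      have := (((h1.const_mul ‖c / (a * b)‖).pow (k + 1)).const_mul C)
      simpa using this
  · refine Eventually.of_forall fun n k => (hC n k).trans ?_
    have h3 : ‖q‖ ^ n ≤ 1 := pow_le_one₀ (norm_nonneg _) hq1.le
    gcongr
    exact mul_le_of_le_one_right (norm_nonneg _) h3

/-- Heine's q-Gauss summation. -/
theorem heine_q_gauss (q a b c : ℂ)
    (hq0 : 0 < ‖q‖) (hq1 : ‖q‖ < 1)
    (ha : a ≠ 0) (hb : b ≠ 0)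
    (harg : ‖c / (a * b)‖ < 1)
    (hc : ∀ j : ℕ, c ≠ q ^ (-(j : ℤ))) :
    ∑' k : ℕ, qPochNat q a k * qPochNat q b k / (qPochNat q q k * qPochNat q c k) *
        (c / (a * b)) ^ k =
      qPochInf q (c / a) * qPochInf q (c / b) / (qPochInf q c * qPochInf q (c / (a * b))) := by
  have hq : q ≠ 0 := norm_pos_iff.mp hq0
  have h : ∀ j : ℕ, 1 - c * q ^ j ≠ 0 := fun j hj => hc j (by
    rw [zpow_neg, zpow_natCast]
    exact eq_inv_of_mul_eq_one_left (sub_eq_zero.mp hj).symm)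
  have n1 := aux_ne q c hq1 h
  have n2 := aux_ne q _ hq1 (aux_q_ne q hq1 _ harg)
  rw [eq_div_iff (mul_ne_zero n1 n2)]
  have l1 := ((aux_tendsto q c hq1).mul (aux_tendsto q (c / (a * b)) hq1)).mul_const
    (∑' k, qgT q a b c k)
  have l2 := ((aux_tendsto q (c / a) hq1).mul (aux_tendsto q (c / b) hq1)).mul
    (aux_lim q a b c hq1 h harg)
  simp only [aux_iter q a b c hq1 ha hb h harg] at l1
  have := tendsto_nhds_unique l1 l2
  rw [mul_one] at this
  rw [← this, mul_comm]
  rfl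
end
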